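/- arXiv:1801.06410 — 3 statements merged into one kernel-verified Lean document; each statement's English description precedes it below -/
import Mathlib

section
/- Let h : Fin 7 → Fin 7 → ℝ be symmetric (h_{pq} = h_{qp} for all p, q). Then the 4-form Σ_{p,q} h_{pq} (e_p ⌟ φ) ∧ (e_q ⌟ φ) equals −2 (Σ_m h_{mm}) ψ + 2 ℓ_ψ h; explicitly, for all i, j, k, l ∈ Fin 7, Σ_{p,q} h_{pq} [(e_p ⌟ φ) ∧ (e_q ⌟ φ)]_{ijkl} = −2 (Σ_m h_{mm}) ψ_{ijkl} + 2 (ℓ_ψ h)_{ijkl}. -/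
open Finset

/-- Kronecker delta on `Fin 7`. -/
def kd (i j : Fin 7) : ℝ := if i = j then 1 else 0

/-- Components of the basic 3-form `e^a ∧ e^b ∧ e^c` (a 3×3 determinant of deltas). -/
def E3 (a b c i j k : Fin 7) : ℝ :=
  kd a i * kd b j * kd c k + kd a j * kd b k * kd c i + kd a k * kd b i * kd c j
    - kd a i * kd b k * kd c j - kd a j * kd b i * kd c k - kd a k * kd b j * kd c i

/-- The standard G₂ 3-form `φ` on `ℝ⁷`, determined by
`φ_{123} = φ_{145} = φ_{167} = φ_{246} = 1`, `φ_{257} = φ_{347} = φ_{356} = −1`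
(indices `1,…,7` correspond to `0,…,6 : Fin 7`). -/
def g2phi (i j k : Fin 7) : ℝ :=
  E3 0 1 2 i j k + E3 0 3 4 i j k + E3 0 5 6 i j k + E3 1 3 5 i j k
    - E3 1 4 6 i j k - E3 2 3 6 i j k - E3 2 4 5 i j k

/-- Components of the basic 4-form `e^a ∧ e^b ∧ e^c ∧ e^d` (a 4×4 determinant of deltas). -/
def E4 (a b c d i j k l : Fin 7) : ℝ :=
  kd a i * E3 b c d j k l - kd a j * E3 b c d i k l
    + kd a k * E3 b c d i j l - kd a l * E3 b c d i j k

/-- The dual 4-form `ψ = ⋆φ` on `ℝ⁷`, determined by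
`ψ_{1247} = ψ_{1256} = ψ_{1346} = 1`, `ψ_{1357} = ψ_{2345} = ψ_{2367} = ψ_{4567} = −1`. -/
def g2psi (i j k l : Fin 7) : ℝ :=
  E4 0 1 3 6 i j k l + E4 0 1 4 5 i j k l + E4 0 2 3 5 i j k l
    - E4 0 2 4 6 i j k l - E4 1 2 3 4 i j k l - E4 1 2 5 6 i j k l - E4 3 4 5 6 i j k l

/-- Wedge product of two 2-forms on `ℝ⁷`, in components:
`(α ∧ β)_{i₁…i₄} = (1/(2!·2!)) Σ_{σ ∈ S₄} sgn(σ) α_{i_{σ(1)} i_{σ(2)}} β_{i_{σ(3)} i_{σ(4)}}`. -/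
noncomputable def wedge22 (α β : Fin 7 → Fin 7 → ℝ) (i j k l : Fin 7) : ℝ :=
  (1 : ℝ) / ((Nat.factorial 2 : ℝ) * (Nat.factorial 2 : ℝ)) *
    ∑ σ : Equiv.Perm (Fin 4),
      ((Equiv.Perm.sign σ : ℤ) : ℝ) *
        (α (![i, j, k, l] (σ 0)) (![i, j, k, l] (σ 1)) *
          β (![i, j, k, l] (σ 2)) (![i, j, k, l] (σ 3)))

/-- Wedge product of a 2-form and a 1-form on `ℝ⁷`, in components. -/
noncomputable def wedge21 (α : Fin 7 → Fin 7 → ℝ) (β : Fin 7 → ℝ) (i j k : Fin 7) : ℝ :=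
  (1 : ℝ) / ((Nat.factorial 2 : ℝ) * (Nat.factorial 1 : ℝ)) *
    ∑ σ : Equiv.Perm (Fin 3),
      ((Equiv.Perm.sign σ : ℤ) : ℝ) *
        (α (![i, j, k] (σ 0)) (![i, j, k] (σ 1)) * β (![i, j, k] (σ 2)))

/-- Wedge product of a 2-form and a 3-form on `ℝ⁷`, in components. -/
noncomputable def wedge23 (α : Fin 7 → Fin 7 → ℝ) (β : Fin 7 → Fin 7 → Fin 7 → ℝ)
    (i1 i2 i3 i4 i5 : Fin 7) : ℝ :=
  (1 : ℝ) / ((Nat.factorial 2 : ℝ) * (Nat.factorial 3 : ℝ)) *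
    ∑ σ : Equiv.Perm (Fin 5),
      ((Equiv.Perm.sign σ : ℤ) : ℝ) *
        (α (![i1, i2, i3, i4, i5] (σ 0)) (![i1, i2, i3, i4, i5] (σ 1)) *
          β (![i1, i2, i3, i4, i5] (σ 2)) (![i1, i2, i3, i4, i5] (σ 3))
            (![i1, i2, i3, i4, i5] (σ 4)))

/-- Wedge product of a 3-form and a 1-form on `ℝ⁷`, in components. -/
noncomputable def wedge31 (α : Fin 7 → Fin 7 → Fin 7 → ℝ) (β : Fin 7 → ℝ)
    (i j k l : Fin 7) : ℝ :=
  (1 : ℝ) / ((Nat.factorial 3 : ℝ) * (Nat.factorial 1 : ℝ)) *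
    ∑ σ : Equiv.Perm (Fin 4),
      ((Equiv.Perm.sign σ : ℤ) : ℝ) *
        (α (![i, j, k, l] (σ 0)) (![i, j, k, l] (σ 1)) (![i, j, k, l] (σ 2)) *
          β (![i, j, k, l] (σ 3)))

/-- Wedge product of a 3-form and a 2-form on `ℝ⁷`, in components. -/
noncomputable def wedge32 (α : Fin 7 → Fin 7 → Fin 7 → ℝ) (β : Fin 7 → Fin 7 → ℝ)
    (i1 i2 i3 i4 i5 : Fin 7) : ℝ :=
  (1 : ℝ) / ((Nat.factorial 3 : ℝ) * (Nat.factorial 2 : ℝ)) *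
    ∑ σ : Equiv.Perm (Fin 5),
      ((Equiv.Perm.sign σ : ℤ) : ℝ) *
        (α (![i1, i2, i3, i4, i5] (σ 0)) (![i1, i2, i3, i4, i5] (σ 1))
            (![i1, i2, i3, i4, i5] (σ 2)) *
          β (![i1, i2, i3, i4, i5] (σ 3)) (![i1, i2, i3, i4, i5] (σ 4)))

/-- Wedge product of two 3-forms on `ℝ⁷`, in components. -/
noncomputable def wedge33 (α β : Fin 7 → Fin 7 → Fin 7 → ℝ)
    (i1 i2 i3 i4 i5 i6 : Fin 7) : ℝ :=
  (1 : ℝ) / ((Nat.factorial 3 : ℝ) * (Nat.factorial 3 : ℝ)) *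
    ∑ σ : Equiv.Perm (Fin 6),
      ((Equiv.Perm.sign σ : ℤ) : ℝ) *
        (α (![i1, i2, i3, i4, i5, i6] (σ 0)) (![i1, i2, i3, i4, i5, i6] (σ 1))
            (![i1, i2, i3, i4, i5, i6] (σ 2)) *
          β (![i1, i2, i3, i4, i5, i6] (σ 3)) (![i1, i2, i3, i4, i5, i6] (σ 4))
            (![i1, i2, i3, i4, i5, i6] (σ 5)))

/-- `(ℓ_φ h)_{ijk} = Σ_m (h_{im} φ_{mjk} + h_{jm} φ_{imk} + h_{km} φ_{ijm})`. -/
noncomputable def ellphi (h : Fin 7 → Fin 7 → ℝ) (i j k : Fin 7) : ℝ :=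
  ∑ m : Fin 7, (h i m * g2phi m j k + h j m * g2phi i m k + h k m * g2phi i j m)

/-- `(ℓ_ψ h)_{ijkl} = Σ_m (h_{im} ψ_{mjkl} + h_{jm} ψ_{imkl} + h_{km} ψ_{ijml} + h_{lm} ψ_{ijkm})`. -/
noncomputable def ellpsi (h : Fin 7 → Fin 7 → ℝ) (i j k l : Fin 7) : ℝ :=
  ∑ m : Fin 7,
    (h i m * g2psi m j k l + h j m * g2psi i m k l + h k m * g2psi i j m l + h l m * g2psi i j k m)

/-- Integer version of `kd`. -/
def kdInt (i j : Fin 7) : ℤ := if i = j then 1 else 0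

/-- Integer version of `E3`. -/
def E3Int (a b c i j k : Fin 7) : ℤ :=
  kdInt a i * kdInt b j * kdInt c k + kdInt a j * kdInt b k * kdInt c i
    + kdInt a k * kdInt b i * kdInt c j - kdInt a i * kdInt b k * kdInt c j
    - kdInt a j * kdInt b i * kdInt c k - kdInt a k * kdInt b j * kdInt c i

/-- Integer version of `g2phi`. -/
def g2phiInt (i j k : Fin 7) : ℤ :=
  E3Int 0 1 2 i j k + E3Int 0 3 4 i j k + E3Int 0 5 6 i j k + E3Int 1 3 5 i j k
    - E3Int 1 4 6 i j k - E3Int 2 3 6 i j k - E3Int 2 4 5 i j k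

/-- Integer version of `E4`. -/
def E4Int (a b c d i j k l : Fin 7) : ℤ :=
  kdInt a i * E3Int b c d j k l - kdInt a j * E3Int b c d i k l
    + kdInt a k * E3Int b c d i j l - kdInt a l * E3Int b c d i j k

/-- Integer version of `g2psi`. -/
def g2psiInt (i j k l : Fin 7) : ℤ :=
  E4Int 0 1 3 6 i j k l + E4Int 0 1 4 5 i j k l + E4Int 0 2 3 5 i j k l
    - E4Int 0 2 4 6 i j k l - E4Int 1 2 3 4 i j k l - E4Int 1 2 5 6 i j k l
    - E4Int 3 4 5 6 i j k l

lemma kdInt_cast (i j : Fin 7) : (kdInt i j : ℝ) = kd i j := by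
  simp [kdInt, kd]

lemma E3Int_cast (a b c i j k : Fin 7) : (E3Int a b c i j k : ℝ) = E3 a b c i j k := by
  simp [E3Int, E3, kdInt_cast]

lemma g2phiInt_cast (i j k : Fin 7) : (g2phiInt i j k : ℝ) = g2phi i j k := by
  simp [g2phiInt, g2phi, E3Int_cast]

lemma g2psiInt_cast (i j k l : Fin 7) : (g2psiInt i j k l : ℝ) = g2psi i j k l := by
  simp [g2psiInt, g2psi, E4Int, E4, E3Int_cast, kdInt_cast]

lemma E3Int_swap_left (a b c i j k : Fin 7) : E3Int a b c j i k = -E3Int a b c i j k := by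
  unfold E3Int; ring

lemma E3Int_swap_right (a b c i j k : Fin 7) : E3Int a b c i k j = -E3Int a b c i j k := by
  unfold E3Int; ring

lemma g2phiInt_swap_right (i j k : Fin 7) : g2phiInt i k j = -g2phiInt i j k := by
  simp only [g2phiInt, E3Int_swap_right _ _ _ i j k]; ring

lemma E4Int_swap_left (a b c d i j k l : Fin 7) :
    E4Int a b c d j i k l = -E4Int a b c d i j k l := by
  simp only [E4Int, E3Int_swap_left _ _ _ i j]; ring

lemma E4Int_swap_mid (a b c d i j k l : Fin 7) :
    E4Int a b c d i k j l = -E4Int a b c d i j k l := by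
  simp only [E4Int, E3Int_swap_left _ _ _ j k, E3Int_swap_right _ _ _ i j k]; ring

lemma E4Int_swap_right (a b c d i j k l : Fin 7) :
    E4Int a b c d i j l k = -E4Int a b c d i j k l := by
  simp only [E4Int, E3Int_swap_right _ _ _ _ k l]; ring

lemma g2psiInt_swap_left (i j k l : Fin 7) : g2psiInt j i k l = -g2psiInt i j k l := by
  simp only [g2psiInt, E4Int_swap_left _ _ _ _ i j]; ring

lemma g2psiInt_swap_mid (i j k l : Fin 7) : g2psiInt i k j l = -g2psiInt i j k l := by
  simp only [g2psiInt, E4Int_swap_mid _ _ _ _ i j k]; ring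

lemma g2psiInt_swap_right (i j k l : Fin 7) : g2psiInt i j l k = -g2psiInt i j k l := by
  simp only [g2psiInt, E4Int_swap_right _ _ _ _ i j k l]; ring

/-- An alternating function of four indices vanishes if it vanishes on increasing indices. -/
lemma eq_zero_of_alternating {ι : Type*} [LinearOrder ι] (D : ι → ι → ι → ι → ℤ)
    (hleft : ∀ i j k l, D j i k l = -D i j k l) (hmid : ∀ i j k l, D i k j l = -D i j k l)
    (hright : ∀ i j k l, D i j l k = -D i j k l)
    (hD : ∀ i j k l, i < j → j < k → k < l → D i j k l = 0) (i j k l : ι) :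
    D i j k l = 0 := by
  have h₁ : ∀ i j k l, i < j → j < k → D i j k l = 0 := by
    intro i j k l hij hjk
    rcases lt_trichotomy k l with h | h | h
    · exact hD i j k l hij hjk h
    · subst h; have := hright i j k k; omega
    · rw [← neg_eq_zero, ← hright]
      rcases lt_trichotomy j l with h' | h' | h'
      · exact hD i j l k hij h' h
      · subst h'; have := hmid i j j k; omega
      · rw [← neg_eq_zero, ← hmid]
        rcases lt_trichotomy i l with h'' | h'' | h''
        · exact hD i l j k h'' h' hjk
        · subst h''; have := hleft i i j k; omega
        · rw [← neg_eq_zero, ← hleft]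
          exact hD l i j k h'' hij hjk
  have h₂ : ∀ i j k l, i < j → D i j k l = 0 := by
    intro i j k l hij
    rcases lt_trichotomy j k with h | h | h
    · exact h₁ i j k l hij h
    · subst h; have := hmid i j j l; omega
    · rw [← neg_eq_zero, ← hmid]
      rcases lt_trichotomy i k with h' | h' | h'
      · exact h₁ i k j l h' h
      · subst h'; have := hleft i i j l; omega
      · rw [← neg_eq_zero, ← hleft]
        exact h₁ k i j l h' hij
  rcases lt_trichotomy i j with h | h | h
  · exact h₂ i j k l h
  · subst h; have := hleft i i k l; omega
  · rw [← neg_eq_zero, ← hleft]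
    exact h₂ j i k l h

/-- The difference of the two sides of the identity for the wedge product of contractions of `φ`,
in integer components. -/
def g2Defect (p q i j k l : Fin 7) : ℤ :=
  (g2phiInt p i j * g2phiInt q k l - g2phiInt p i k * g2phiInt q j l
    + g2phiInt p i l * g2phiInt q j k + g2phiInt p j k * g2phiInt q i l
    - g2phiInt p j l * g2phiInt q i k + g2phiInt p k l * g2phiInt q i j) -
  (-2 * kdInt p q * g2psiInt i j k l
    + (kdInt i p * g2psiInt q j k l + kdInt j p * g2psiInt i q k l
      + kdInt k p * g2psiInt i j q l + kdInt l p * g2psiInt i j k q)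
    + (kdInt i q * g2psiInt p j k l + kdInt j q * g2psiInt i p k l
      + kdInt k q * g2psiInt i j p l + kdInt l q * g2psiInt i j k p))

lemma g2Defect_of_lt : ∀ i j k l : Fin 7, i < j → j < k → k < l →
    ∀ p q, g2Defect p q i j k l = 0 := by
  decide +kernel

lemma g2Defect_eq_zero (p q i j k l : Fin 7) : g2Defect p q i j k l = 0 := by
  refine eq_zero_of_alternating (g2Defect p q) ?_ ?_ ?_
    (fun i j k l hij hjk hkl => g2Defect_of_lt i j k l hij hjk hkl p q) i j k l
  · intro i j k l
    simp only [g2Defect, g2phiInt_swap_right _ i j, g2psiInt_swap_left i j,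
      g2psiInt_swap_left i p, g2psiInt_swap_left i q, g2psiInt_swap_left p j,
      g2psiInt_swap_left q j]
    ring
  · intro i j k l
    simp only [g2Defect, g2phiInt_swap_right _ j k, g2psiInt_swap_mid _ j k,
      g2psiInt_swap_mid _ j p, g2psiInt_swap_mid _ j q, g2psiInt_swap_mid _ p k,
      g2psiInt_swap_mid _ q k]
    ring
  · intro i j k l
    simp only [g2Defect, g2phiInt_swap_right _ k l, g2psiInt_swap_right _ _ k l,
      g2psiInt_swap_right _ _ k p, g2psiInt_swap_right _ _ k q, g2psiInt_swap_right _ _ p l,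
      g2psiInt_swap_right _ _ q l]
    ring

lemma sum_perm_fin_succ {M : Type*} [AddCommMonoid M] {n : ℕ}
    (f : Equiv.Perm (Fin (n + 1)) → M) :
    ∑ σ, f σ = ∑ a, ∑ τ, f (Equiv.Perm.decomposeFin.symm (a, τ)) := by
  rw [← Equiv.Perm.decomposeFin.symm.sum_comp, Fintype.sum_prod_type]

lemma wedge22_of_antisymm (α β : Fin 7 → Fin 7 → ℝ) (hα : ∀ a b, α a b = -α b a)
    (hβ : ∀ a b, β a b = -β b a) (i j k l : Fin 7) :
    wedge22 α β i j k l = α i j * β k l - α i k * β j l + α i l * β j k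
      + α j k * β i l - α j l * β i k + α k l * β i j := by
  have h_one : (1 : Fin 4) = Fin.succ 0 := rfl
  have h_two : (2 : Fin 4) = Fin.succ (Fin.succ 0) := rfl
  have h_three : (3 : Fin 4) = Fin.succ (Fin.succ (Fin.succ 0)) := rfl
  simp only [wedge22, h_one, h_two, h_three, sum_perm_fin_succ,
    Equiv.Perm.decomposeFin_symm_apply_succ, Equiv.Perm.decomposeFin_symm_apply_zero]
  simp [Fin.sum_univ_succ, Equiv.Perm.decomposeFin.symm_sign, Equiv.swap_apply_def]
  rw [hα j i, hα k i, hα l i, hα k j, hα l j, hα l k, hβ j i, hβ k i, hβ l i, hβ k j, hβ l j,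
    hβ l k]
  ring

lemma wedge22_g2phi (p q i j k l : Fin 7) :
    wedge22 (fun a b => g2phi p a b) (fun a b => g2phi q a b) i j k l =
      -2 * kd p q * g2psi i j k l
        + (kd i p * g2psi q j k l + kd j p * g2psi i q k l
          + kd k p * g2psi i j q l + kd l p * g2psi i j k q)
        + (kd i q * g2psi p j k l + kd j q * g2psi i p k l
          + kd k q * g2psi i j p l + kd l q * g2psi i j k p) := by
  have hanti : ∀ r a b, g2phi r a b = -g2phi r b a := fun r a b => by
    rw [← g2phiInt_cast, ← g2phiInt_cast, g2phiInt_swap_right]; push_cast; rfl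
  rw [wedge22_of_antisymm _ _ (hanti p) (hanti q), ← sub_eq_zero]
  simpa [g2Defect, g2phiInt_cast, g2psiInt_cast, kdInt_cast] using
    congrArg (Int.cast : ℤ → ℝ) (g2Defect_eq_zero p q i j k l)

/-- Proposition 2.5, first identity: for symmetric `h`,
`Σ_{p,q} h_{pq} (e_p ⌟ φ) ∧ (e_q ⌟ φ) = −2 (tr h) ψ + 2 ℓ_ψ h`. -/
theorem stmt_10 (h : Fin 7 → Fin 7 → ℝ) (hsymm : ∀ p q, h p q = h q p) (i j k l : Fin 7) :
    ∑ p : Fin 7, ∑ q : Fin 7,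
        h p q * wedge22 (fun a b => g2phi p a b) (fun a b => g2phi q a b) i j k l =
      -2 * (∑ m : Fin 7, h m m) * g2psi i j k l + 2 * ellpsi h i j k l := by
  have hdiag : ∑ p, ∑ q, h p q * (-2 * kd p q * g2psi i j k l) =
      -2 * (∑ m, h m m) * g2psi i j k l := by
    simp [kd, mul_sum, mul_comm, mul_left_comm]
  have hleft : ∑ p, ∑ q, h p q * (kd i p * g2psi q j k l + kd j p * g2psi i q k l
      + kd k p * g2psi i j q l + kd l p * g2psi i j k q) = ellpsi h i j k l := by
    rw [sum_comm]
    simp [kd, ellpsi, mul_add, sum_add_distrib]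
  have hright : ∑ p, ∑ q, h p q * (kd i q * g2psi p j k l + kd j q * g2psi i p k l
      + kd k q * g2psi i j p l + kd l q * g2psi i j k p) = ellpsi h i j k l := by
    rw [sum_comm, ← hleft]
    simp only [hsymm]
  simp only [wedge22_g2phi]
  rw [two_mul, ← add_assoc, ← hdiag]
  nth_rewrite 1 [← hleft]
  rw [← hright]
  simp only [← sum_add_distrib, ← mul_add]
end

section
/- Let β : Fin 7 → Fin 7 → ℝ be antisymmetric (β_{ij} = −β_{ji}) and suppose Σ_{i,j} β_{ij} φ_{ijk} = 0 for all k ∈ Fin 7 (i.e. β lies in the component Ω²₁₄ of the G₂ decomposition of 2-forms). Then the 3-form Σ_p (e_p ⌟ φ) ∧ (e_p ⌟ β) is identically zero, and the 4-form Σ_p (e_p ⌟ ψ) ∧ (e_p ⌟ β) is identically zero. -/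
open Finset

/-- The sum over `Sym(3)` collapses when the 2-form is antisymmetric. -/
theorem wedge21_of_alternating (α : Fin 7 → Fin 7 → ℝ) (b : Fin 7 → ℝ)
    (hα : ∀ i j, α i j = -α j i) (i j k : Fin 7) :
    wedge21 α b i j k = α i j * b k - α i k * b j + α j k * b i := by
  have two : ∀ (p : Fin 3) (e : Equiv.Perm (Fin 2)),
      Equiv.Perm.decomposeFin.symm (p, e) 2 = Equiv.swap 0 p (e 1).succ := fun p e =>
    Equiv.Perm.decomposeFin_symm_apply_succ e p 1
  simp [wedge21, two, Equiv.swap_apply_def, Finset.univ_perm_fin_succ,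
    Fin.sum_univ_succ, ← Finset.univ_product_univ, Finset.sum_product, Finset.sum_map,
    Equiv.Perm.decomposeFin.symm_sign]
  rw [hα j i, hα k j, hα k i]
  ring

/-- The sum over `Sym(4)` collapses when the 3-form is alternating. -/
theorem wedge31_of_alternating (α : Fin 7 → Fin 7 → Fin 7 → ℝ) (b : Fin 7 → ℝ)
    (h₁ : ∀ i j k, α i j k = -α j i k) (h₂ : ∀ i j k, α i j k = -α i k j) (i j k l : Fin 7) :
    wedge31 α b i j k l =
      α i j k * b l - α i j l * b k + α i k l * b j - α j k l * b i := by
  have two' : ∀ (p : Fin 3) (e : Equiv.Perm (Fin 2)),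
      Equiv.Perm.decomposeFin.symm (p, e) 2 = Equiv.swap 0 p (e 1).succ := fun p e =>
    Equiv.Perm.decomposeFin_symm_apply_succ e p 1
  have two : ∀ (p : Fin 4) (e : Equiv.Perm (Fin 3)),
      Equiv.Perm.decomposeFin.symm (p, e) 2 = Equiv.swap 0 p (e 1).succ := fun p e =>
    Equiv.Perm.decomposeFin_symm_apply_succ e p 1
  have three : ∀ (p : Fin 4) (e : Equiv.Perm (Fin 3)),
      Equiv.Perm.decomposeFin.symm (p, e) 3 = Equiv.swap 0 p (e 2).succ := fun p e =>
    Equiv.Perm.decomposeFin_symm_apply_succ e p 2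
  simp [wedge31, two', two, three, Equiv.swap_apply_def, Nat.factorial,
    Finset.univ_perm_fin_succ, Fin.sum_univ_succ, ← Finset.univ_product_univ, Finset.sum_product, Finset.sum_map,
    Equiv.Perm.decomposeFin.symm_sign]
  have e : ∀ a b c, α b a c = -α a b c ∧ α a c b = -α a b c ∧ α b c a = α a b c ∧
      α c a b = α a b c ∧ α c b a = -α a b c := fun a b c => by
    have := h₁ a b c; have := h₂ a b c; have := h₁ a c b; have := h₂ b a c; have := h₁ b c a
    refine ⟨?_, ?_, ?_, ?_, ?_⟩ <;> linarith
  obtain ⟨a₁, a₂, a₃, a₄, a₅⟩ := e i j k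
  obtain ⟨b₁, b₂, b₃, b₄, b₅⟩ := e i j l
  obtain ⟨c₁, c₂, c₃, c₄, c₅⟩ := e i k l
  obtain ⟨d₁, d₂, d₃, d₄, d₅⟩ := e j k l
  simp only [a₁, a₂, a₃, a₄, a₅, b₁, b₂, b₃, b₄, b₅, c₁, c₂, c₃, c₄, c₅, d₁, d₂, d₃, d₄, d₅]
  ring

theorem g2phi_swap₂ (i j k : Fin 7) : g2phi i j k = -g2phi i k j := by
  simp only [g2phi, E3]; ring

theorem g2psi_swap₂ (i j k l : Fin 7) : g2psi i j k l = -g2psi i k j l := by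
  simp only [g2psi, E4, E3]; ring

theorem g2psi_swap₃ (i j k l : Fin 7) : g2psi i j k l = -g2psi i j l k := by
  simp only [g2psi, E4, E3]; ring

/-- An alternating array of rank 3 vanishes if its strictly increasing components do. -/
theorem eq_zero_of_alternating_three {ι : Type*} [LinearOrder ι] (F : ι → ι → ι → ℝ)
    (h₁ : ∀ i j k, F i j k = -F j i k) (h₂ : ∀ i j k, F i j k = -F i k j)
    (h : ∀ i j k, i < j → j < k → F i j k = 0) (i j k : ι) : F i j k = 0 := by
  have e₁ : ∀ i k, F i i k = 0 := fun i k => by linarith [h₁ i i k]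
  have e₂ : ∀ i j, F i j j = 0 := fun i j => by linarith [h₂ i j j]
  have s : ∀ i j k, i < j → F i j k = 0 := by
    intro i j k hij
    rcases lt_trichotomy j k with hjk | rfl | hkj
    · exact h i j k hij hjk
    · exact e₂ i j
    · rw [h₂, neg_eq_zero]
      rcases lt_trichotomy i k with hik | rfl | hki
      · exact h i k j hik hkj
      · exact e₁ i j
      · rw [h₁, h k i j hki hij, neg_zero]
  rcases lt_trichotomy i j with hij | rfl | hji
  · exact s i j k hij
  · exact e₁ i k
  · rw [h₁, s j i k hji, neg_zero]

/-- An alternating array of rank 4 vanishes if its strictly increasing components do. -/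
theorem eq_zero_of_alternating_four {ι : Type*} [LinearOrder ι] (F : ι → ι → ι → ι → ℝ)
    (h₁ : ∀ i j k l, F i j k l = -F j i k l) (h₂ : ∀ i j k l, F i j k l = -F i k j l)
    (h₃ : ∀ i j k l, F i j k l = -F i j l k)
    (h : ∀ i j k l, i < j → j < k → k < l → F i j k l = 0) (i j k l : ι) : F i j k l = 0 := by
  refine eq_zero_of_alternating_three (F i) (h₂ i) (h₃ i) (fun j k l hjk hkl => ?_) j k l
  have e : ∀ i k l, F i i k l = 0 := fun i k l => by linarith [h₁ i i k l]
  rcases lt_trichotomy i j with hij | rfl | hji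
  · exact h i j k l hij hjk hkl
  · exact e i k l
  rw [h₁, neg_eq_zero]
  rcases lt_trichotomy i k with hik | rfl | hki
  · exact h j i k l hji hik hkl
  · rw [h₂, neg_eq_zero]; linarith [h₂ j i i l]
  rw [h₂, neg_eq_zero]
  rcases lt_trichotomy i l with hil | rfl | hli
  · exact h j k i l hjk hki hil
  · linarith [h₃ j k i i]
  · rw [h₃, h j k l i hjk hkl hli, neg_zero]

/-- The equations cutting out `Ω²₁₄`, in coordinates. -/
theorem omega14_equations (β : Fin 7 → Fin 7 → ℝ) (hanti : ∀ i j, β i j = -β j i)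
    (h14 : ∀ k : Fin 7, ∑ i : Fin 7, ∑ j : Fin 7, β i j * g2phi i j k = 0) :
    β 1 2 + β 3 4 + β 5 6 = 0 ∧ β 0 2 - β 3 5 + β 4 6 = 0 ∧ β 0 1 - β 3 6 - β 4 5 = 0 ∧
      β 0 4 + β 1 5 - β 2 6 = 0 ∧ β 0 3 + β 1 6 + β 2 5 = 0 ∧ β 0 6 - β 1 3 + β 2 4 = 0 ∧
      β 0 5 - β 1 4 - β 2 3 = 0 := by
  have h := h14
  simp [Fin.forall_fin_succ, Fin.sum_univ_succ, g2phi, E3, kd] at h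
  obtain ⟨h0, h1, h2, h3, h4, h5, h6⟩ := h
  refine ⟨?_, ?_, ?_, ?_, ?_, ?_, ?_⟩
  · linarith [hanti 2 1, hanti 4 3, hanti 6 5]
  · linarith [hanti 2 0, hanti 5 3, hanti 6 4]
  · linarith [hanti 1 0, hanti 6 3, hanti 5 4]
  · linarith [hanti 4 0, hanti 5 1, hanti 6 2]
  · linarith [hanti 3 0, hanti 6 1, hanti 5 2]
  · linarith [hanti 6 0, hanti 3 1, hanti 4 2]
  · linarith [hanti 5 0, hanti 4 1, hanti 3 2]

set_option maxHeartbeats 4000000 in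
theorem sum_wedge21_g2phi_eq_zero (β : Fin 7 → Fin 7 → ℝ) (hanti : ∀ i j, β i j = -β j i)
    (h14 : ∀ k : Fin 7, ∑ i : Fin 7, ∑ j : Fin 7, β i j * g2phi i j k = 0) (i j k : Fin 7) :
    ∑ p : Fin 7, wedge21 (fun a b => g2phi p a b) (fun a => β p a) i j k = 0 := by
  have hβ : ∀ i, β i i = 0 := fun i => by linarith [hanti i i]
  obtain ⟨h0, h1, h2, h3, h4, h5, h6⟩ := omega14_equations β hanti h14
  have key : ∀ i j k p, wedge21 (fun a b => g2phi p a b) (fun a => β p a) i j k =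
      g2phi p i j * β p k - g2phi p i k * β p j + g2phi p j k * β p i := fun i j k p =>
    wedge21_of_alternating _ _ (g2phi_swap₂ p) i j k
  simp only [key]
  refine eq_zero_of_alternating_three (fun i j k =>
      ∑ p, (g2phi p i j * β p k - g2phi p i k * β p j + g2phi p j k * β p i))
    (fun i j k => ?_) (fun i j k => ?_) (fun i j k hij hjk => ?_) i j k
  · rw [← Finset.sum_neg_distrib]
    refine Finset.sum_congr rfl fun p _ => ?_
    rw [g2phi_swap₂ p i j]; ring
  · rw [← Finset.sum_neg_distrib]
    refine Finset.sum_congr rfl fun p _ => ?_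
    rw [g2phi_swap₂ p j k]; ring
  · fin_cases i <;> fin_cases j <;> first | exact absurd hij (by decide) | skip
    all_goals fin_cases k <;> first | exact absurd hjk (by decide) | skip
    all_goals simp [Fin.sum_univ_succ, g2phi, E3, kd, hβ]
    all_goals
      linarith [hanti 1 0, hanti 2 0, hanti 3 0, hanti 4 0, hanti 5 0, hanti 6 0, hanti 2 1,
        hanti 3 1, hanti 4 1, hanti 5 1, hanti 6 1, hanti 3 2, hanti 4 2, hanti 5 2,
        hanti 6 2, hanti 4 3, hanti 5 3, hanti 6 3, hanti 5 4, hanti 6 4, hanti 6 5]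

set_option maxHeartbeats 4000000 in
theorem sum_wedge31_g2psi_eq_zero (β : Fin 7 → Fin 7 → ℝ) (hanti : ∀ i j, β i j = -β j i)
    (h14 : ∀ k : Fin 7, ∑ i : Fin 7, ∑ j : Fin 7, β i j * g2phi i j k = 0) (i j k l : Fin 7) :
    ∑ p : Fin 7, wedge31 (fun a b c => g2psi p a b c) (fun a => β p a) i j k l = 0 := by
  have hβ : ∀ i, β i i = 0 := fun i => by linarith [hanti i i]
  obtain ⟨h0, h1, h2, h3, h4, h5, h6⟩ := omega14_equations β hanti h14
  have key : ∀ i j k l p, wedge31 (fun a b c => g2psi p a b c) (fun a => β p a) i j k l =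
      g2psi p i j k * β p l - g2psi p i j l * β p k + g2psi p i k l * β p j
        - g2psi p j k l * β p i := fun i j k l p =>
    wedge31_of_alternating _ _ (g2psi_swap₂ p) (g2psi_swap₃ p) i j k l
  simp only [key]
  refine eq_zero_of_alternating_four (fun i j k l =>
      ∑ p, (g2psi p i j k * β p l - g2psi p i j l * β p k + g2psi p i k l * β p j
        - g2psi p j k l * β p i)) (fun i j k l => ?_) (fun i j k l => ?_)
    (fun i j k l => ?_) (fun i j k l hij hjk hkl => ?_) i j k l
  · rw [← Finset.sum_neg_distrib]
    refine Finset.sum_congr rfl fun p _ => ?_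
    rw [g2psi_swap₂ p i j k, g2psi_swap₂ p i j l]; ring
  · rw [← Finset.sum_neg_distrib]
    refine Finset.sum_congr rfl fun p _ => ?_
    rw [g2psi_swap₃ p i j k, g2psi_swap₂ p j k l]; ring
  · rw [← Finset.sum_neg_distrib]
    refine Finset.sum_congr rfl fun p _ => ?_
    rw [g2psi_swap₃ p i k l, g2psi_swap₃ p j k l]; ring
  · fin_cases i <;> fin_cases j <;> first | exact absurd hij (by decide) | skip
    all_goals fin_cases k <;> first | exact absurd hjk (by decide) | skip
    all_goals fin_cases l <;> first | exact absurd hkl (by decide) | skip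
    all_goals simp [Fin.sum_univ_succ, g2psi, E4, E3, kd, hβ]
    all_goals
      linarith [hanti 1 0, hanti 2 0, hanti 3 0, hanti 4 0, hanti 5 0, hanti 6 0, hanti 2 1,
        hanti 3 1, hanti 4 1, hanti 5 1, hanti 6 1, hanti 3 2, hanti 4 2, hanti 5 2,
        hanti 6 2, hanti 4 3, hanti 5 3, hanti 6 3, hanti 5 4, hanti 6 4, hanti 6 5]

/-- Lemma 2.11: if `β` is a 2-form in `Ω²₁₄` (i.e. `Σ_{i,j} β_{ij} φ_{ijk} = 0` for all `k`),
then `Σ_p (e_p ⌟ φ) ∧ (e_p ⌟ β) = 0` and `Σ_p (e_p ⌟ ψ) ∧ (e_p ⌟ β) = 0`. -/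
theorem stmt_18 (β : Fin 7 → Fin 7 → ℝ) (hanti : ∀ i j, β i j = -β j i)
    (h14 : ∀ k : Fin 7, ∑ i : Fin 7, ∑ j : Fin 7, β i j * g2phi i j k = 0) :
    (∀ i j k : Fin 7,
      ∑ p : Fin 7, wedge21 (fun a b => g2phi p a b) (fun a => β p a) i j k = 0) ∧
    (∀ i j k l : Fin 7,
      ∑ p : Fin 7, wedge31 (fun a b c => g2psi p a b c) (fun a => β p a) i j k l = 0) := by
  exact ⟨sum_wedge21_g2phi_eq_zero β hanti h14, sum_wedge31_g2psi_eq_zero β hanti h14⟩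
end

section
/- Let h : Fin 7 → Fin 7 → ℝ be symmetric (h_{pq} = h_{qp}) and traceless (Σ_m h_{mm} = 0). Then the 4-form Σ_p (e_p ⌟ φ) ∧ (e_p ⌟ (ℓ_φ h)) equals −ℓ_ψ h; explicitly, for all i, j, k, l ∈ Fin 7, Σ_p [(e_p ⌟ φ) ∧ (e_p ⌟ (ℓ_φ h))]_{ijkl} = −(ℓ_ψ h)_{ijkl}. -/
open Finset

/-- The integer components of `g2phi`: `{i, j, k}` supports `φ` iff it is a line of the Fano plane,
and the bit `7 * i + j` of the numeral is set iff the component on that line is positive. -/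
def intPhi (i j k : Fin 7) : ℤ :=
  if i ≠ j ∧ (i.val + 1) ^^^ (j.val + 1) = k.val + 1 then
    if Nat.testBit 112770651022890 (7 * i.val + j.val) then 1 else -1
  else 0

/-- Integer version of `kd`. -/
def intKd (i j : Fin 7) : ℤ := if i = j then 1 else 0

/-- The contraction of `φ` with itself over one index. -/
def intContr (a b c d : Fin 7) : ℤ :=
  intPhi 0 a b * intPhi 0 c d + intPhi 1 a b * intPhi 1 c d + intPhi 2 a b * intPhi 2 c d +
  intPhi 3 a b * intPhi 3 c d + intPhi 4 a b * intPhi 4 c d + intPhi 5 a b * intPhi 5 c d +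
  intPhi 6 a b * intPhi 6 c d

/-- The integer components of `g2psi`, expressed through the contraction identity for `φ`. -/
def intPsi (a b c d : Fin 7) : ℤ :=
  intKd a c * intKd b d - intKd a d * intKd b c - intContr a b c d

/-- Integer version of `E3`. -/
def intE3 (a b c i j k : Fin 7) : ℤ :=
  intKd a i * intKd b j * intKd c k + intKd a j * intKd b k * intKd c i
    + intKd a k * intKd b i * intKd c j - intKd a i * intKd b k * intKd c j
    - intKd a j * intKd b i * intKd c k - intKd a k * intKd b j * intKd c i

/-- Integer version of `E4`. -/
def intE4 (a b c d i j k l : Fin 7) : ℤ :=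
  intKd a i * intE3 b c d j k l - intKd a j * intE3 b c d i k l
    + intKd a k * intE3 b c d i j l - intKd a l * intE3 b c d i j k

theorem sum_intE3_eq_intPhi : ∀ i j k : Fin 7,
    intE3 0 1 2 i j k + intE3 0 3 4 i j k + intE3 0 5 6 i j k + intE3 1 3 5 i j k
      - intE3 1 4 6 i j k - intE3 2 3 6 i j k - intE3 2 4 5 i j k = intPhi i j k := by
  decide +kernel

theorem sum_intE4_eq_intPsi : ∀ i j k l : Fin 7,
    intE4 0 1 3 6 i j k l + intE4 0 1 4 5 i j k l + intE4 0 2 3 5 i j k l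
      - intE4 0 2 4 6 i j k l - intE4 1 2 3 4 i j k l - intE4 1 2 5 6 i j k l
      - intE4 3 4 5 6 i j k l = intPsi i j k l := by
  decide +kernel

theorem kd_eq_intKd (i j : Fin 7) : kd i j = intKd i j := by
  simp [kd, intKd]

theorem E3_eq_intE3 (a b c i j k : Fin 7) : E3 a b c i j k = intE3 a b c i j k := by
  simp only [E3, intE3, kd_eq_intKd]
  push_cast
  rfl

theorem E4_eq_intE4 (a b c d i j k l : Fin 7) : E4 a b c d i j k l = intE4 a b c d i j k l := by
  simp only [E4, intE4, kd_eq_intKd, E3_eq_intE3]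
  push_cast
  rfl

theorem g2phi_eq_intPhi (i j k : Fin 7) : g2phi i j k = intPhi i j k := by
  rw [← sum_intE3_eq_intPhi]
  simp only [g2phi, E3_eq_intE3]
  push_cast
  rfl

theorem g2psi_eq_intPsi (i j k l : Fin 7) : g2psi i j k l = intPsi i j k l := by
  rw [← sum_intE4_eq_intPsi]
  simp only [g2psi, E4_eq_intE4]
  push_cast
  rfl

theorem intPhi_swap_right : ∀ i j k : Fin 7, intPhi i k j = -intPhi i j k := by
  decide +kernel

theorem intPsi_swap_left : ∀ i j k l : Fin 7, intPsi j i k l = -intPsi i j k l := by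
  decide +kernel

theorem intPsi_swap_mid : ∀ i j k l : Fin 7, intPsi i k j l = -intPsi i j k l := by
  decide +kernel

theorem intPsi_swap_right : ∀ i j k l : Fin 7, intPsi i j l k = -intPsi i j k l := by
  decide +kernel

/-- An alternating array vanishes as soon as its components at increasing indices do. -/
theorem eq_zero_of_alternating_s19 {α : Type*} [LinearOrder α] (F : α → α → α → α → ℤ)
    (h₁ : ∀ a b c d, F b a c d = -F a b c d) (h₂ : ∀ a b c d, F a c b d = -F a b c d)
    (h₃ : ∀ a b c d, F a b d c = -F a b c d)
    (h₀ : ∀ a b, a < b → ∀ c, b < c → ∀ d, c < d → F a b c d = 0) (a b c d : α) :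
    F a b c d = 0 := by
  have e₁ : ∀ a c d, F a a c d = 0 := fun a c d => by have := h₁ a a c d; lia
  have e₂ : ∀ a b d, F a b b d = 0 := fun a b d => by have := h₂ a b b d; lia
  have e₃ : ∀ a b c, F a b c c = 0 := fun a b c => by have := h₃ a b c c; lia
  have s₁ : ∀ a b c d, a < b → b < c → F a b c d = 0 := by
    intro a b c d hab hbc
    rcases lt_trichotomy c d with hcd | rfl | hdc
    · exact h₀ a b hab c hbc d hcd
    · exact e₃ a b c
    rw [h₃, neg_eq_zero]
    rcases lt_trichotomy b d with hbd | rfl | hdb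
    · exact h₀ a b hab d hbd c hdc
    · exact e₂ a b c
    rw [h₂, neg_eq_zero]
    rcases lt_trichotomy a d with had | rfl | hda
    · exact h₀ a d had b hdb c hbc
    · exact e₁ a b c
    rw [h₁, neg_eq_zero]
    exact h₀ d a hda b hab c hbc
  have s₂ : ∀ a b c d, a < b → F a b c d = 0 := by
    intro a b c d hab
    rcases lt_trichotomy b c with hbc | rfl | hcb
    · exact s₁ a b c d hab hbc
    · exact e₂ a b d
    rw [h₂, neg_eq_zero]
    rcases lt_trichotomy a c with hac | rfl | hca
    · exact s₁ a c b d hac hcb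
    · exact e₁ a b d
    rw [h₁, neg_eq_zero]
    exact s₁ c a b d hca hab
  rcases lt_trichotomy a b with hab | rfl | hba
  · exact s₂ a b c d hab
  · exact e₁ a c d
  rw [h₁, neg_eq_zero]
  exact s₂ b a c d hba

/-- The components of `(e_p ⌟ φ) ∧ (e_m ⌟ φ)`. -/
def intWedge (p m a b c d : Fin 7) : ℤ :=
  intPhi p a b * intPhi m c d - intPhi p a c * intPhi m b d + intPhi p a d * intPhi m b c
    + intPhi p c d * intPhi m a b - intPhi p b d * intPhi m a c + intPhi p b c * intPhi m a d

/-- The components of `e^p ∧ (e_m ⌟ ψ)`. -/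
def intSubst (p m a b c d : Fin 7) : ℤ :=
  intKd p a * intPsi m b c d + intKd p b * intPsi a m c d + intKd p c * intPsi a b m d
    + intKd p d * intPsi a b c m

theorem intWedge_eq_of_lt : ∀ p m a b : Fin 7, a < b → ∀ c, b < c → ∀ d, c < d →
    intWedge p m a b c d + 2 * intKd p m * intPsi a b c d
      - intSubst p m a b c d - intSubst m p a b c d = 0 := by
  decide +kernel

theorem intWedge_eq (p m a b c d : Fin 7) :
    intWedge p m a b c d = -2 * intKd p m * intPsi a b c d
      + intSubst p m a b c d + intSubst m p a b c d := by
  have key := eq_zero_of_alternating_s19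
    (fun a b c d => intWedge p m a b c d + 2 * intKd p m * intPsi a b c d
      - intSubst p m a b c d - intSubst m p a b c d) ?_ ?_ ?_ (intWedge_eq_of_lt p m) a b c d
  · linarith
  · intro a b c d
    simp only [intWedge, intSubst]
    rw [intPhi_swap_right p a b, intPhi_swap_right m a b, intPsi_swap_left a b c d,
      intPsi_swap_left a m c d, intPsi_swap_left m b c d, intPsi_swap_left a p c d,
      intPsi_swap_left p b c d, intPsi_swap_left a b m d, intPsi_swap_left a b c m,
      intPsi_swap_left a b p d, intPsi_swap_left a b c p]
    ring
  · intro a b c d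
    simp only [intWedge, intSubst]
    rw [intPhi_swap_right p b c, intPhi_swap_right m b c, intPsi_swap_mid a b c d,
      intPsi_swap_mid m b c d, intPsi_swap_mid p b c d, intPsi_swap_mid a m c d,
      intPsi_swap_mid a b m d, intPsi_swap_mid a p c d, intPsi_swap_mid a b p d,
      intPsi_swap_mid a b c m, intPsi_swap_mid a b c p]
    ring
  · intro a b c d
    simp only [intWedge, intSubst]
    rw [intPhi_swap_right p c d, intPhi_swap_right m c d, intPsi_swap_right a b c d,
      intPsi_swap_right m b c d, intPsi_swap_right p b c d, intPsi_swap_right a m c d,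
      intPsi_swap_right a p c d, intPsi_swap_right a b m d, intPsi_swap_right a b c m,
      intPsi_swap_right a b p d, intPsi_swap_right a b c p]
    ring

theorem sum_g2phi_mul_g2phi (a b c d : Fin 7) :
    ∑ p, g2phi p a b * g2phi p c d = kd a c * kd b d - kd a d * kd b c - g2psi a b c d := by
  simp only [g2phi_eq_intPhi, g2psi_eq_intPsi, kd_eq_intKd, intPsi, intContr, Fin.sum_univ_seven]
  push_cast
  ring

theorem g2phi_swap_right (i j k : Fin 7) : g2phi i k j = -g2phi i j k := by
  simp [g2phi_eq_intPhi, intPhi_swap_right i j k]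

theorem g2psi_swap_left (i j k l : Fin 7) : g2psi j i k l = -g2psi i j k l := by
  simp [g2psi_eq_intPsi, intPsi_swap_left i j k l]

theorem g2psi_swap_mid (i j k l : Fin 7) : g2psi i k j l = -g2psi i j k l := by
  simp [g2psi_eq_intPsi, intPsi_swap_mid i j k l]

theorem g2psi_swap_right (i j k l : Fin 7) : g2psi i j l k = -g2psi i j k l := by
  simp [g2psi_eq_intPsi, intPsi_swap_right i j k l]

theorem ellphi_swap_right (h : Fin 7 → Fin 7 → ℝ) (i j k : Fin 7) :
    ellphi h i k j = -ellphi h i j k := by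
  simp only [ellphi, ← Finset.sum_neg_distrib]
  refine Finset.sum_congr rfl fun m _ => ?_
  rw [g2phi_swap_right m j k, g2phi_swap_right i j m, g2phi_swap_right i m k]
  ring

theorem wedge22_eq_of_alternating {α β : Fin 7 → Fin 7 → ℝ} (hα : ∀ a b, α b a = -α a b)
    (hβ : ∀ a b, β b a = -β a b) (i j k l : Fin 7) :
    wedge22 α β i j k l = α i j * β k l - α i k * β j l + α i l * β j k
      + α k l * β i j - α j l * β i k + α j k * β i l := by
  have hperm : ∀ {n : ℕ} (f : Equiv.Perm (Fin (n + 1)) → ℝ),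
      ∑ σ, f σ = ∑ p, ∑ τ, f (Equiv.Perm.decomposeFin.symm (p, τ)) := fun f => by
    rw [← Equiv.sum_comp Equiv.Perm.decomposeFin.symm, Fintype.sum_prod_type]
  simp only [wedge22, hperm, Fin.sum_univ_succ, Finset.univ_unique, Finset.sum_singleton]
  have happly₂ : ∀ {n : ℕ} (p : Fin (n + 3)) (e : Equiv.Perm (Fin (n + 2))),
      Equiv.Perm.decomposeFin.symm (p, e) 2 = Equiv.swap 0 p (e 1).succ :=
    fun p e => Equiv.Perm.decomposeFin_symm_apply_succ e p 1
  have happly₃ : ∀ (p : Fin 4) (e : Equiv.Perm (Fin 3)),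
      Equiv.Perm.decomposeFin.symm (p, e) 3 = Equiv.swap 0 p (e 2).succ :=
    fun p e => Equiv.Perm.decomposeFin_symm_apply_succ e p 2
  simp [Equiv.Perm.decomposeFin.symm_sign, happly₂, happly₃, Equiv.swap_apply_def]
  rw [hα i j, hα i k, hα i l, hα j k, hα j l, hα k l, hβ i j, hβ i k, hβ i l, hβ j k, hβ j l,
    hβ k l]
  ring

theorem sum_mul_kd (f : Fin 7 → ℝ) (a : Fin 7) : ∑ m, f m * kd a m = f a := by
  simp [kd]

/-- The contraction of `e_p ⌟ φ` with `e_p ⌟ (ℓ_φ h)`. -/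
theorem sum_g2phi_mul_ellphi (h : Fin 7 → Fin 7 → ℝ) (a b c d : Fin 7) :
    ∑ p, g2phi p a b * ellphi h p c d =
      ∑ p, ∑ m, h p m * (g2phi p a b * g2phi m c d)
        + (h c a * kd b d - h c b * kd a d + h d b * kd a c - h d a * kd b c)
        - ∑ m, h c m * g2psi m a b d + ∑ m, h d m * g2psi m a b c := by
  have hc : ∑ p, ∑ m, g2phi p a b * (h c m * g2phi p m d) =
      h c a * kd b d - h c b * kd a d - ∑ m, h c m * g2psi m a b d := by
    rw [Finset.sum_comm]
    have : ∀ m, ∑ p, g2phi p a b * (h c m * g2phi p m d) =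
        h c m * kd a m * kd b d - h c m * kd b m * kd a d - h c m * g2psi m a b d := by
      intro m
      rw [g2psi_swap_left a m b d, g2psi_swap_mid a b m d]
      simp only [mul_left_comm _ (h c m), ← Finset.mul_sum, sum_g2phi_mul_g2phi a b m d]
      ring
    simp only [this, Finset.sum_sub_distrib, ← Finset.sum_mul, sum_mul_kd]
  have hd : ∑ p, ∑ m, g2phi p a b * (h d m * g2phi p c m) =
      h d b * kd a c - h d a * kd b c + ∑ m, h d m * g2psi m a b c := by
    rw [Finset.sum_comm]
    have : ∀ m, ∑ p, g2phi p a b * (h d m * g2phi p c m) =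
        h d m * kd b m * kd a c - h d m * kd a m * kd b c + h d m * g2psi m a b c := by
      intro m
      rw [g2psi_swap_left a m b c, g2psi_swap_mid a b m c, g2psi_swap_right a b c m]
      simp only [mul_left_comm _ (h d m), ← Finset.mul_sum, sum_g2phi_mul_g2phi a b c m]
      ring
    simp only [this, Finset.sum_sub_distrib, Finset.sum_add_distrib, ← Finset.sum_mul, sum_mul_kd]
  have hp : ∑ p, ∑ m, g2phi p a b * (h p m * g2phi m c d) =
      ∑ p, ∑ m, h p m * (g2phi p a b * g2phi m c d) :=
    Finset.sum_congr rfl fun p _ => Finset.sum_congr rfl fun m _ => by ring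
  simp only [ellphi, Finset.mul_sum, mul_add, Finset.sum_add_distrib]
  rw [hc, hd, hp]
  ring

theorem sum_mul_intSubst (h : Fin 7 → Fin 7 → ℝ) (i j k l : Fin 7) :
    ∑ p, ∑ m, h p m * (intSubst p m i j k l : ℝ) = ellpsi h i j k l := by
  rw [Finset.sum_comm, ellpsi]
  refine Finset.sum_congr rfl fun m _ => ?_
  simp [intSubst, intKd, g2psi_eq_intPsi, mul_add, Finset.sum_add_distrib]

/-- The contraction of `h` with `(e_p ⌟ φ) ∧ (e_m ⌟ φ)`. -/
theorem sum_mul_intWedge (h : Fin 7 → Fin 7 → ℝ) (hsymm : ∀ p q, h p q = h q p)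
    (htr : ∑ m : Fin 7, h m m = 0) (i j k l : Fin 7) :
    ∑ p, ∑ m, h p m * (intWedge p m i j k l : ℝ) = 2 * ellpsi h i j k l := by
  have htrace : ∑ p, ∑ m, h p m * (-2 * (intKd p m : ℝ) * (intPsi i j k l : ℝ)) = 0 := by
    simp [intKd, ← Finset.sum_mul, htr]
  have hswap : ∑ p, ∑ m, h p m * (intSubst m p i j k l : ℝ) = ellpsi h i j k l := by
    rw [Finset.sum_comm, ← sum_mul_intSubst]
    simp only [hsymm]
  simp only [intWedge_eq]
  push_cast
  simp only [mul_add, Finset.sum_add_distrib, htrace, hswap, sum_mul_intSubst]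
  ring

theorem ellpsi_eq (h : Fin 7 → Fin 7 → ℝ) (i j k l : Fin 7) :
    ellpsi h i j k l = ∑ m, h i m * g2psi m j k l - ∑ m, h j m * g2psi m i k l
      + ∑ m, h k m * g2psi m i j l - ∑ m, h l m * g2psi m i j k := by
  simp only [ellpsi, ← Finset.sum_add_distrib, ← Finset.sum_sub_distrib]
  refine Finset.sum_congr rfl fun m _ => ?_
  rw [g2psi_swap_left m i k l, g2psi_swap_mid i m j l, g2psi_swap_left m i j l,
    g2psi_swap_right i j m k, g2psi_swap_mid i m j k, g2psi_swap_left m i j k]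
  ring

/-- From Proposition 2.10 (the `Ω³₂₇ → Ω⁴₂₇` component of `ι_B`): for `h` symmetric and
traceless, `Σ_p (e_p ⌟ φ) ∧ (e_p ⌟ (ℓ_φ h)) = −ℓ_ψ h`, in components. -/
theorem stmt_19 (h : Fin 7 → Fin 7 → ℝ) (hsymm : ∀ p q, h p q = h q p)
    (htr : ∑ m : Fin 7, h m m = 0) (i j k l : Fin 7) :
    ∑ p : Fin 7, wedge22 (fun a b => g2phi p a b) (fun a b => ellphi h p a b) i j k l =
      -(ellpsi h i j k l) := by
  have hcyc : ∀ x a b c, ∑ m, h x m * g2psi m b c a = ∑ m, h x m * g2psi m a b c := by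
    intro x a b c
    refine Finset.sum_congr rfl fun m _ => ?_
    rw [g2psi_swap_right m b a c, g2psi_swap_mid m a b c, neg_neg]
  have hflip : ∀ x a b c, ∑ m, h x m * g2psi m a c b = -∑ m, h x m * g2psi m a b c := by
    intro x a b c
    rw [← Finset.sum_neg_distrib]
    refine Finset.sum_congr rfl fun m _ => ?_
    rw [g2psi_swap_right m a b c, mul_neg]
  have hkd : ∀ a b, kd a b = kd b a := fun a b => by simp only [kd, eq_comm]
  have hquad := sum_mul_intWedge h hsymm htr i j k l
  simp only [intWedge] at hquad
  push_cast at hquad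
  simp only [← g2phi_eq_intPhi, mul_add, mul_sub, Finset.sum_add_distrib,
    Finset.sum_sub_distrib] at hquad
  simp only [wedge22_eq_of_alternating (fun a b => g2phi_swap_right _ a b)
    (fun a b => ellphi_swap_right h _ a b), Finset.sum_add_distrib, Finset.sum_sub_distrib,
    sum_g2phi_mul_ellphi]
  rw [ellpsi_eq] at hquad ⊢
  rw [hflip l i j k, hflip j i k l, hflip k i j l, hcyc i j k l, hcyc j i k l, hflip i j k l,
    hcyc k i j l, hcyc l i j k, hsymm k i, hsymm k j, hsymm l j, hsymm l i, hsymm j i, hsymm l k,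
    hkd k j, hkd l k, hkd l j, hkd k i, hkd l i, hkd j i]
  linear_combination hquad
end
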